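/- arXiv:2111.06169 — 2 statements merged into one kernel-verified Lean document; each statement's English description precedes it below -/
import Mathlib

section
/- Let c be a simple-model cost function on the infinite grid graph G with l layers, let r = (x_r, y_r, z_r) and s = (x_s, y_s, z_s) be vertices of G, and for z ∈ {1, …, l} let v_z = (x_s, y_r, z). Let d̄_z denote the minimum cost of a path from r to v_z in the subgraph of G obtained by deleting all horizontal edges on layers 1, …, z−1, and let d_z := dist_{(G,c)}(r, v_z) be the minimum cost of a path from r to v_z in G itself. Then d_1 = d̄_1, and for every z ∈ {2, …, l}, d_z = min{ d̄_z, d_{z−1} + c_{z−1, z} }. -/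
/-- Vertices of the infinite grid graph: `(x, y, z)` where `z` is the layer. -/
abbrev Vtx : Type := ℤ × ℤ × ℤ

/-- Two vertices of the infinite grid graph with layers `1, …, l` are adjacent iff both have
their layer coordinate in `{1, …, l}` and they differ by exactly `1` in exactly one
coordinate.  An edge changing the first coordinate is horizontal, one changing the second
coordinate is vertical, and one changing the third coordinate is a via. -/
def Adj (l : ℤ) (u v : Vtx) : Prop :=
  1 ≤ u.2.2 ∧ u.2.2 ≤ l ∧ 1 ≤ v.2.2 ∧ v.2.2 ≤ l ∧
    |u.1 - v.1| + |u.2.1 - v.2.1| + |u.2.2 - v.2.2| = 1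

/-- Simple-model edge cost: a horizontal (resp. vertical) edge on layer `z` costs `ch z`
(resp. `cv z`) and a via between layers `z` and `z+1` costs `cvia z`. -/
def ecost (ch cv cvia : ℤ → ℝ) (u v : Vtx) : ℝ :=
  if u.1 ≠ v.1 then ch u.2.2
  else if u.2.1 ≠ v.2.1 then cv u.2.2
  else cvia (min u.2.2 v.2.2)

/-- The cost of a walk (given as the list of its vertices) is the sum of its edge costs. -/
def wcost (c : Vtx → Vtx → ℝ) : List Vtx → ℝ
  | [] => 0
  | [_] => 0
  | u :: v :: P => c u v + wcost c (v :: P)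

/-- `P` is a walk from `u` to `v` with respect to the adjacency relation `A`. -/
def IsWalkA (A : Vtx → Vtx → Prop) (P : List Vtx) (u v : Vtx) : Prop :=
  P ≠ [] ∧ P.Chain' A ∧ P.head? = some u ∧ P.getLast? = some v

/-- The distance between two vertices: the infimum cost of a walk between them. -/
noncomputable def gdistA (A : Vtx → Vtx → Prop) (c : Vtx → Vtx → ℝ) (u v : Vtx) : ℝ :=
  sInf { m : ℝ | ∃ P, IsWalkA A P u v ∧ wcost c P = m }

/-- The distance from a vertex to a set of vertices. -/
noncomputable def gdistSetA (A : Vtx → Vtx → Prop) (c : Vtx → Vtx → ℝ) (u : Vtx)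
    (T : Set Vtx) : ℝ :=
  sInf { m : ℝ | ∃ P v, v ∈ T ∧ IsWalkA A P u v ∧ wcost c P = m }

/-- Adjacency in the subgraph of the grid graph with `l` layers obtained by deleting all
horizontal edges on the layers `1, …, z₀ − 1`. -/
def AdjNH (l z₀ : ℤ) (u v : Vtx) : Prop :=
  Adj l u v ∧ (u.1 ≠ v.1 → z₀ ≤ u.2.2)

/-- `Reach A c u v m`: there is an `A`-walk from `u` to `v` of cost `m`. -/
inductive Reach (A : Vtx → Vtx → Prop) (c : Vtx → Vtx → ℝ) : Vtx → Vtx → ℝ → Prop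
  | refl (u : Vtx) : Reach A c u u 0
  | cons {u v w : Vtx} {m : ℝ} : A u v → Reach A c v w m → Reach A c u w (c u v + m)

theorem Reach.of_walk {A : Vtx → Vtx → Prop} {c : Vtx → Vtx → ℝ} (P : List Vtx) :
    ∀ u v, IsWalkA A P u v → Reach A c u v (wcost c P) := by
  induction P with
  | nil => intro u v h; exact absurd rfl h.1
  | cons a P ih =>
    intro u v h
    obtain ⟨_, h2, h3, h4⟩ := h
    simp at h3
    subst h3
    cases P with
    | nil =>
      simp at h4
      subst h4
      exact Reach.refl _
    | cons b P =>
      have h2' : A a b ∧ (b :: P).IsChain A := List.isChain_cons_cons.1 h2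
      refine Reach.cons h2'.1 (ih b v ⟨by simp, h2'.2, by simp, ?_⟩)
      simpa [List.getLast?_cons_cons] using h4

theorem Reach.to_walk {A : Vtx → Vtx → Prop} {c : Vtx → Vtx → ℝ} {u v : Vtx} {m : ℝ}
    (h : Reach A c u v m) : ∃ P, IsWalkA A P u v ∧ wcost c P = m := by
  induction h with
  | refl u => exact ⟨[u], ⟨by simp, List.isChain_singleton _, by simp, by simp⟩, rfl⟩
  | @cons u v w m hA _ ih =>
    obtain ⟨P, ⟨h1, h2, h3, h4⟩, h5⟩ := ih
    cases P with
    | nil => exact absurd rfl h1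
    | cons b P =>
      simp at h3
      subst h3
      refine ⟨u :: b :: P, ⟨by simp, List.isChain_cons_cons.2 ⟨hA, h2⟩, by simp, ?_⟩, ?_⟩
      · simpa [List.getLast?_cons_cons] using h4
      · simp [wcost, h5]

theorem gdistA_eq (A : Vtx → Vtx → Prop) (c : Vtx → Vtx → ℝ) (u v : Vtx) :
    gdistA A c u v = sInf {m : ℝ | Reach A c u v m} := by
  unfold gdistA
  congr 1
  ext m
  constructor
  · rintro ⟨P, h, rfl⟩
    exact Reach.of_walk P u v h
  · exact Reach.to_walk

theorem Reach.trans {A : Vtx → Vtx → Prop} {c : Vtx → Vtx → ℝ} {u v w : Vtx} {m n : ℝ}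
    (h : Reach A c u v m) (h' : Reach A c v w n) : Reach A c u w (m + n) := by
  induction h with
  | refl u => simpa using h'
  | cons hA _ ih =>
    rw [add_assoc]
    exact Reach.cons hA (ih h')

theorem Reach.single {A : Vtx → Vtx → Prop} {c : Vtx → Vtx → ℝ} {u v : Vtx}
    (h : A u v) : Reach A c u v (c u v) := by
  simpa using Reach.cons (c := c) h (Reach.refl v)

theorem Reach.mono {A B : Vtx → Vtx → Prop} {c : Vtx → Vtx → ℝ} {u v : Vtx} {m : ℝ}
    (hAB : ∀ u v, A u v → B u v) (h : Reach A c u v m) : Reach B c u v m := by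
  induction h with
  | refl u => exact Reach.refl u
  | cons hA _ ih => exact Reach.cons (hAB _ _ hA) ih

theorem Reach.symm {A : Vtx → Vtx → Prop} {c : Vtx → Vtx → ℝ} {u v : Vtx} {m : ℝ}
    (hA : ∀ u v, A u v → A v u ∧ c v u = c u v) (h : Reach A c u v m) : Reach A c v u m := by
  induction h with
  | refl u => exact Reach.refl u
  | @cons u v w m h _ ih =>
    obtain ⟨h1, h2⟩ := hA _ _ h
    rw [add_comm, ← h2]
    exact ih.trans (Reach.single h1)

/-- The three kinds of edges. -/
theorem Adj.cases {l : ℤ} {u v : Vtx} (h : Adj l u v) :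
    (1 ≤ u.2.2 ∧ u.2.2 ≤ l ∧ 1 ≤ v.2.2 ∧ v.2.2 ≤ l) ∧
    ((u.1 ≠ v.1 ∧ |u.1 - v.1| = 1 ∧ u.2.1 = v.2.1 ∧ u.2.2 = v.2.2) ∨
     (u.1 = v.1 ∧ u.2.1 ≠ v.2.1 ∧ u.2.2 = v.2.2) ∨
     (u.1 = v.1 ∧ u.2.1 = v.2.1 ∧ (v.2.2 = u.2.2 + 1 ∨ u.2.2 = v.2.2 + 1))) := by
  obtain ⟨h1, h2, h3, h4, h5⟩ := h
  refine ⟨⟨h1, h2, h3, h4⟩, ?_⟩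
  generalize u.1 = a at *
  generalize v.1 = b at *
  generalize u.2.1 = a' at *
  generalize v.2.1 = b' at *
  generalize u.2.2 = a'' at *
  generalize v.2.2 = b'' at *
  clear h1 h2 h3 h4
  rcases abs_cases (a - b) with ⟨e, _⟩ | ⟨e, _⟩ <;>
  rcases abs_cases (a' - b') with ⟨e', _⟩ | ⟨e', _⟩ <;>
  rcases abs_cases (a'' - b'') with ⟨e'', _⟩ | ⟨e'', _⟩ <;>
  rw [e, e', e''] at h5 <;> rw [e] <;> omega

theorem AdjNH.symm {l z₀ : ℤ} (ch cv cvia : ℤ → ℝ) (u v : Vtx) (h : AdjNH l z₀ u v) :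
    AdjNH l z₀ v u ∧ ecost ch cv cvia v u = ecost ch cv cvia u v := by
  obtain ⟨h1, h2⟩ := h
  have hc := h1.cases
  refine ⟨⟨⟨hc.1.2.2.1, hc.1.2.2.2, hc.1.1, hc.1.2.1, ?_⟩, ?_⟩, ?_⟩
  · rw [abs_sub_comm v.1, abs_sub_comm v.2.1, abs_sub_comm v.2.2]; exact h1.2.2.2.2
  · intro hne
    have := h2 (Ne.symm hne)
    rcases hc.2 with h | h | h
    · omega
    · omega
    · exact absurd h.1.symm hne
  · unfold ecost
    rcases hc.2 with h | h | h
    · simp [h.1, h.1.symm, h.2.2.2]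
    · simp [h.1, h.2.1, h.2.1.symm, h.2.2]
    · simp [h.1, h.2.1, min_comm]

/-- Via potential. -/
noncomputable def pot (cvia : ℤ → ℝ) (a : ℤ) : ℝ := ∑ i ∈ Finset.range (a - 1).toNat, cvia (i + 1)

theorem pot_succ (cvia : ℤ → ℝ) (a : ℤ) (ha : 1 ≤ a) : pot cvia (a + 1) = pot cvia a + cvia a := by
  unfold pot
  have : (a + 1 - 1).toNat = (a - 1).toNat + 1 := by omega
  rw [this, Finset.sum_range_succ]
  congr 2
  omega

theorem reach_up (l z₀ : ℤ) (ch cv cvia : ℤ → ℝ) (x y a : ℤ) (ha : 1 ≤ a) (n : ℕ) :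
    a + n ≤ l → Reach (AdjNH l z₀) (ecost ch cv cvia) (x, y, a) (x, y, a + n)
      (pot cvia (a + n) - pot cvia a) := by
  induction n with
  | zero => intro _; simpa using Reach.refl _
  | succ n ih =>
    intro h
    push_cast at h ⊢
    have h1 := ih (by omega)
    have h2 : AdjNH l z₀ (x, y, a + n) (x, y, a + (n + 1)) := by
      refine ⟨⟨by simp; omega, by simp; omega, by simp; omega, by simp; omega, ?_⟩, by simp⟩
      simp
    have h3 := h1.trans (Reach.single (c := ecost ch cv cvia) h2)
    convert h3 using 1
    have e : a + ((n : ℤ) + 1) = (a + n) + 1 := by ring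
    have : ecost ch cv cvia (x, y, a + n) (x, y, a + (n + 1)) = cvia (a + n) := by
      simp [ecost]
    rw [this, e, pot_succ cvia _ (by omega)]
    ring

theorem pot_mono (l : ℤ) (cvia : ℤ → ℝ) (hcvia : ∀ z, 1 ≤ z → z < l → 0 < cvia z)
    (a : ℤ) (ha : 1 ≤ a) (n : ℕ) : a + n ≤ l → pot cvia a ≤ pot cvia (a + n) := by
  induction n with
  | zero => intro _; simp
  | succ n ih =>
    intro h
    push_cast at h ⊢
    have h1 := ih (by omega)
    have e : a + ((n : ℤ) + 1) = (a + n) + 1 := by ring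
    rw [e, pot_succ cvia _ (by omega)]
    have := hcvia (a + n) (by omega) (by omega)
    linarith

theorem pot_mono' (l : ℤ) (cvia : ℤ → ℝ) (hcvia : ∀ z, 1 ≤ z → z < l → 0 < cvia z)
    (a b : ℤ) (ha : 1 ≤ a) (hab : a ≤ b) (hb : b ≤ l) : pot cvia a ≤ pot cvia b := by
  have := pot_mono l cvia hcvia a ha (b - a).toNat (by omega)
  rwa [show a + ((b - a).toNat : ℤ) = b by omega] at this

theorem reach_via (l z₀ : ℤ) (ch cv cvia : ℤ → ℝ) (hcvia : ∀ z, 1 ≤ z → z < l → 0 < cvia z)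
    (x y a b : ℤ) (ha : 1 ≤ a) (hal : a ≤ l) (hb : 1 ≤ b) (hbl : b ≤ l) :
    Reach (AdjNH l z₀) (ecost ch cv cvia) (x, y, a) (x, y, b) |pot cvia a - pot cvia b| := by
  rcases le_total a b with h | h
  · have := reach_up l z₀ ch cv cvia x y a ha (b - a).toNat (by omega)
    rw [show a + ((b - a).toNat : ℤ) = b by omega] at this
    rwa [abs_sub_comm, abs_of_nonneg]
    linarith [pot_mono' l cvia hcvia a b ha h hbl]
  · have := reach_up l z₀ ch cv cvia x y b hb (a - b).toNat (by omega)
    rw [show b + ((a - b).toNat : ℤ) = a by omega] at this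
    rw [abs_of_nonneg]
    · exact this.symm (AdjNH.symm ch cv cvia)
    linarith [pot_mono' l cvia hcvia b a hb h hal]

theorem reach_right (l z₀ : ℤ) (ch cv cvia : ℤ → ℝ) (x y h : ℤ) (h1 : 1 ≤ h) (hl : h ≤ l)
    (hz : z₀ ≤ h) (n : ℕ) : Reach (AdjNH l z₀) (ecost ch cv cvia) (x, y, h) (x + n, y, h)
      (n * ch h) := by
  induction n with
  | zero => simpa using Reach.refl _
  | succ n ih =>
    have h2 : AdjNH l z₀ (x + n, y, h) (x + (n + 1), y, h) :=
      ⟨⟨h1, hl, h1, hl, by simp⟩, fun _ => hz⟩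
    have h3 := ih.trans (Reach.single (c := ecost ch cv cvia) h2)
    have : ecost ch cv cvia (x + n, y, h) (x + (n + 1), y, h) = ch h := by
      simp [ecost]
    rw [this] at h3
    push_cast
    convert h3 using 1
    ring

theorem reach_hor (l z₀ : ℤ) (ch cv cvia : ℤ → ℝ) (x x' y h : ℤ) (h1 : 1 ≤ h) (hl : h ≤ l)
    (hz : z₀ ≤ h) : Reach (AdjNH l z₀) (ecost ch cv cvia) (x, y, h) (x', y, h)
      ((|x - x'| : ℤ) * ch h) := by
  rcases le_total x x' with hx | hx
  · have := reach_right l z₀ ch cv cvia x y h h1 hl hz (x' - x).toNat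
    rw [show x + ((x' - x).toNat : ℤ) = x' by omega] at this
    convert this using 2
    rw [abs_sub_comm, abs_of_nonneg (by omega), ← Int.cast_natCast]
    congr 1
    omega
  · have := reach_right l z₀ ch cv cvia x' y h h1 hl hz (x - x').toNat
    rw [show x' + ((x - x').toNat : ℤ) = x by omega] at this
    convert this.symm (AdjNH.symm ch cv cvia) using 2
    rw [abs_of_nonneg (by omega), ← Int.cast_natCast]
    congr 1
    omega

theorem reach_full (l z₀ : ℤ) (ch cv cvia : ℤ → ℝ) (hcvia : ∀ z, 1 ≤ z → z < l → 0 < cvia z)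
    (x x' y a b h : ℤ) (ha : 1 ≤ a) (hal : a ≤ l) (hb : 1 ≤ b) (hbl : b ≤ l)
    (h1 : 1 ≤ h) (hl : h ≤ l) (hz : z₀ ≤ h) :
    Reach (AdjNH l z₀) (ecost ch cv cvia) (x, y, a) (x', y, b)
      (|pot cvia a - pot cvia h| + (|x - x'| : ℤ) * ch h + |pot cvia h - pot cvia b|) :=
  ((reach_via l z₀ ch cv cvia hcvia x y a h ha hal h1 hl).trans
    (reach_hor l z₀ ch cv cvia x x' y h h1 hl hz)).trans
    (reach_via l z₀ ch cv cvia hcvia x' y h b h1 hl hb hbl)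

theorem lower (l : ℤ) (ch cv cvia : ℤ → ℝ)
    (hch : ∀ z, 1 ≤ z → z ≤ l → 0 < ch z)
    (hcv : ∀ z, 1 ≤ z → z ≤ l → 0 < cv z)
    (hcvia : ∀ z, 1 ≤ z → z < l → 0 < cvia z)
    {u w : Vtx} {m : ℝ} (h : Reach (Adj l) (ecost ch cv cvia) u w m) :
    1 ≤ u.2.2 → u.2.2 ≤ l → ∃ h : ℤ, 1 ≤ h ∧ h ≤ l ∧
      |pot cvia u.2.2 - pot cvia h| + (|u.1 - w.1| : ℤ) * ch h + |pot cvia h - pot cvia w.2.2| ≤ m := by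
  induction h with
  | refl u => intro h1 h2; exact ⟨u.2.2, h1, h2, by simp⟩
  | @cons u v w m hA _ ih =>
    intro h1 h2
    obtain ⟨hb, hc⟩ := hA.cases
    obtain ⟨h, hh1, hhl, hm⟩ := ih hb.2.2.1 hb.2.2.2
    rcases hc with ⟨e1, e2, e3, e4⟩ | ⟨e1, e2, e3⟩ | ⟨e1, e2, e3⟩
    · have hcost : ecost ch cv cvia u v = ch u.2.2 := by simp [ecost, e1]
      rw [hcost]
      rw [← e4] at hm
      have htri : ((|u.1 - w.1| : ℤ) : ℝ) ≤ 1 + (|v.1 - w.1| : ℤ) := by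
        have := abs_sub_le u.1 v.1 w.1
        rw [e2] at this
        exact_mod_cast this
      have hn : (0 : ℝ) ≤ ((|v.1 - w.1| : ℤ) : ℝ) := by exact_mod_cast abs_nonneg _
      have p1 := hch _ hh1 hhl
      have p2 := hch _ h1 h2
      rcases le_total (ch h) (ch u.2.2) with hle | hle
      · refine ⟨h, hh1, hhl, ?_⟩
        nlinarith
      · refine ⟨u.2.2, h1, h2, ?_⟩
        have := abs_sub_le (pot cvia u.2.2) (pot cvia h) (pot cvia w.2.2)
        simp only [sub_self, abs_zero]
        nlinarith
    · have hcost : ecost ch cv cvia u v = cv u.2.2 := by simp [ecost, e1, e2]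
      rw [hcost]
      rw [← e3, ← e1] at hm
      have := hcv _ h1 h2
      exact ⟨h, hh1, hhl, by linarith⟩
    · have hcost : ecost ch cv cvia u v = cvia (min u.2.2 v.2.2) := by simp [ecost, e1, e2]
      rw [hcost]
      rw [← e1] at hm
      refine ⟨h, hh1, hhl, ?_⟩
      have ht := abs_sub_le (pot cvia u.2.2) (pot cvia v.2.2) (pot cvia h)
      have : |pot cvia u.2.2 - pot cvia v.2.2| ≤ cvia (min u.2.2 v.2.2) := by
        rcases e3 with e3 | e3
        · have p := hcvia u.2.2 h1 (by omega)
          rw [e3, pot_succ cvia _ h1, min_eq_left (by omega), abs_sub_comm, add_sub_cancel_left,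
            abs_of_pos p]
        · have p := hcvia v.2.2 hb.2.2.1 (by omega)
          rw [e3, pot_succ cvia _ hb.2.2.1, min_eq_right (by omega), add_sub_cancel_left,
            abs_of_pos p]
      linarith

/-- With `v_z = (x_s, y_r, z)`, `d̄_z` the distance from `r` to `v_z` in the
subgraph without horizontal edges on layers `1, …, z−1`, and `d_z` the distance from `r` to
`v_z` in `G` itself, we have `d_1 = d̄_1` and
`d_z = min (d̄_z) (d_{z−1} + c_{z−1,z})` for `2 ≤ z ≤ l`. -/
theorem stmt4 (l : ℤ) (hl : 1 ≤ l) (ch cv cvia : ℤ → ℝ)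
    (hch : ∀ z, 1 ≤ z → z ≤ l → 0 < ch z)
    (hcv : ∀ z, 1 ≤ z → z ≤ l → 0 < cv z)
    (hcvia : ∀ z, 1 ≤ z → z < l → 0 < cvia z)
    (r s : Vtx) (hr : 1 ≤ r.2.2 ∧ r.2.2 ≤ l) (hs : 1 ≤ s.2.2 ∧ s.2.2 ≤ l) :
    gdistA (Adj l) (ecost ch cv cvia) r (s.1, r.2.1, 1)
        = gdistA (AdjNH l 1) (ecost ch cv cvia) r (s.1, r.2.1, 1) ∧
      ∀ z : ℤ, 2 ≤ z → z ≤ l →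
        gdistA (Adj l) (ecost ch cv cvia) r (s.1, r.2.1, z)
          = min (gdistA (AdjNH l z) (ecost ch cv cvia) r (s.1, r.2.1, z))
              (gdistA (Adj l) (ecost ch cv cvia) r (s.1, r.2.1, z - 1) + cvia (z - 1)) := by
  have hNH : AdjNH l 1 = Adj l := by
    funext u v
    exact propext ⟨fun h => h.1, fun h => ⟨h, fun _ => h.1⟩⟩
  refine ⟨by rw [hNH], ?_⟩
  intro z hz hzl
  obtain ⟨xr, yr, zr⟩ := r
  obtain ⟨hr1, hr2⟩ := hr
  simp only at hr1 hr2 ⊢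
  have hsub : ∀ z₀ u v, AdjNH l z₀ u v → Adj l u v := fun _ _ _ h => h.1
  have hnn : ∀ (u w : Vtx) m, 1 ≤ u.2.2 → u.2.2 ≤ l →
      Reach (Adj l) (ecost ch cv cvia) u w m → 0 ≤ m := by
    intro u w m h1 h2 h
    obtain ⟨k, k1, k2, hk⟩ := lower l ch cv cvia hch hcv hcvia h h1 h2
    refine le_trans ?_ hk
    have p1 := hch k k1 k2
    have hn : (0 : ℝ) ≤ ((|u.1 - w.1| : ℤ) : ℝ) := by exact_mod_cast abs_nonneg _
    positivity
  have hbdd : ∀ w, BddBelow {m : ℝ | Reach (Adj l) (ecost ch cv cvia) (xr, yr, zr) w m} :=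
    fun w => ⟨0, fun m hm => hnn _ w m hr1 hr2 hm⟩
  have hbdd' : ∀ z₀ w,
      BddBelow {m : ℝ | Reach (AdjNH l z₀) (ecost ch cv cvia) (xr, yr, zr) w m} :=
    fun z₀ w => ⟨0, fun m hm => hnn _ w m hr1 hr2 (hm.mono (hsub z₀))⟩
  have hne' : ∀ z₀ b, z₀ ≤ l → 1 ≤ b → b ≤ l →
      {m : ℝ | Reach (AdjNH l z₀) (ecost ch cv cvia) (xr, yr, zr) (s.1, yr, b) m}.Nonempty :=
    fun z₀ b hz0 hb hbl => ⟨_, reach_full l z₀ ch cv cvia hcvia xr s.1 yr zr b l hr1 hr2 hb hbl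
      hl le_rfl hz0⟩
  have hne : ∀ b, 1 ≤ b → b ≤ l →
      {m : ℝ | Reach (Adj l) (ecost ch cv cvia) (xr, yr, zr) (s.1, yr, b) m}.Nonempty := by
    intro b hb hbl
    obtain ⟨m, hm⟩ := hne' 1 b hl hb hbl
    exact ⟨m, Reach.mono (hsub 1) hm⟩
  have hp : pot cvia z = pot cvia (z - 1) + cvia (z - 1) := by
    have := pot_succ cvia (z - 1) (by omega)
    rwa [sub_add_cancel] at this
  have hv := hcvia (z - 1) (by omega) (by omega)
  simp only [gdistA_eq]
  apply le_antisymm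
  · apply le_min
    · apply le_csInf (hne' z z hzl (by omega) hzl)
      intro m hm
      exact csInf_le (hbdd _) (Reach.mono (hsub z) hm)
    · rw [← sub_le_iff_le_add]
      apply le_csInf (hne (z - 1) (by omega) (by omega))
      intro m hm
      rw [sub_le_iff_le_add]
      apply csInf_le (hbdd _)
      have h2 := (reach_via l z ch cv cvia hcvia s.1 yr (z - 1) z (by omega) (by omega)
        (by omega) hzl).mono (hsub z)
      rw [hp, abs_sub_comm, add_sub_cancel_left, abs_of_pos hv] at h2
      exact Reach.trans hm h2
  · apply le_csInf (hne z (by omega) hzl)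
    intro m hm
    obtain ⟨k, k1, k2, hk⟩ := lower l ch cv cvia hch hcv hcvia hm hr1 hr2
    simp only at hk
    refine le_trans ?_ hk
    rcases le_or_gt z k with hzk | hzk
    · apply min_le_of_left_le
      exact csInf_le (hbdd' _ _) (reach_full l z ch cv cvia hcvia xr s.1 yr zr z k hr1 hr2
        (by omega) hzl k1 k2 hzk)
    · apply min_le_of_right_le
      have h3 := csInf_le (hbdd _) ((reach_full l 1 ch cv cvia hcvia xr s.1 yr zr (z - 1) k hr1 hr2
        (by omega) (by omega) k1 k2 k1).mono (hsub 1))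
      have hm1 := pot_mono' l cvia hcvia k (z - 1) k1 (by omega) (by omega)
      have a1 : |pot cvia k - pot cvia (z - 1)| = pot cvia (z - 1) - pot cvia k := by
        rw [abs_sub_comm, abs_of_nonneg (by linarith)]
      have a2 : |pot cvia k - pot cvia z| = pot cvia z - pot cvia k := by
        rw [abs_sub_comm, abs_of_nonneg (by linarith)]
      rw [a1] at h3
      rw [a2]
      linarith
end

section
/- Let c be a general-model cost function (depending on tile and direction) on the infinite grid graph G with l layers, let T ⊆ V be nonempty and consistent with the grid, and let k' := min{k, (q+1)·l}, where k is the number of distinct values among all horizontal and vertical costs c_z^{ij↔} and c_z^{ij↕}. Then for every i ∈ {0, …, p}, j ∈ {1, …, q} and z ∈ {1, …, l} there exists a set F of at most 2k' + 1 affine functions f : ℝ → ℝ such that for every vertex (x, υ^j, z) ∈ V with ξ^i ≤ x ≤ ξ^{i+1}, the distance dist_{(G,c)}((x, υ^j, z), T) equals min{f(x) : f ∈ F}; moreover, the slope of each f ∈ F is either 0 or of the form +c_{z'}^{ij'↔} or −c_{z'}^{ij'↔} for some j' ∈ {0, …, q} and z' ∈ {1, …, l}. -/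
/-- `inSeg n ξ i x` states that the coordinate `x` lies in the `i`-th interval
`[ξ^i, ξ^{i+1}]` of the rectilinear grid given by `ξ¹ ≤ … ≤ ξ^n`
(with the conventions `ξ⁰ = −∞` and `ξ^{n+1} = ∞`). -/
def inSeg (n : ℕ) (ξ : ℕ → ℤ) (i : ℕ) (x : ℤ) : Prop :=
  (i = 0 ∨ ξ i ≤ x) ∧ (i = n ∨ x ≤ ξ (i + 1))

/-- General-model edge cost: an edge lying in the tile with indices `(i, j, z)` costs
`ch i j z`, `cv i j z` or `cvia i j z` according to its direction (for a via between layers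
`z` and `z+1` the lower layer `z` is used), and an edge lying in more than one tile gets the
minimum of the applicable costs. -/
noncomputable def gecost (p q : ℕ) (ξ υ : ℕ → ℤ) (ch cv cvia : ℕ → ℕ → ℤ → ℝ)
    (u v : Vtx) : ℝ :=
  sInf { m : ℝ | ∃ i j : ℕ, i ≤ p ∧ j ≤ q ∧
    inSeg p ξ i u.1 ∧ inSeg p ξ i v.1 ∧ inSeg q υ j u.2.1 ∧ inSeg q υ j v.2.1 ∧
    m = if u.1 ≠ v.1 then ch i j u.2.2
        else if u.2.1 ≠ v.2.1 then cv i j u.2.2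
        else cvia i j (min u.2.2 v.2.2) }

/-- The rectangle with corner grid indices `i₁, i₂` (in x), `j₁, j₂` (in y), on layer `ζ`. -/
def GridRect (ξ υ : ℕ → ℤ) (i₁ i₂ j₁ j₂ : ℕ) (ζ : ℤ) : Set Vtx :=
  { w | ξ i₁ ≤ w.1 ∧ w.1 ≤ ξ i₂ ∧ υ j₁ ≤ w.2.1 ∧ w.2.1 ≤ υ j₂ ∧ w.2.2 = ζ }

/-- `T` is consistent with the grid: it is a finite union of rectangles whose corner
coordinates are grid coordinates `ξ^{i⁻} ≤ x ≤ ξ^{i⁺}`, `υ^{j⁻} ≤ y ≤ υ^{j⁺}` with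
`1 ≤ i⁻ ≤ i⁺ ≤ p`, `1 ≤ j⁻ ≤ j⁺ ≤ q`, each on a single layer `ζ ∈ {1, …, l}`. -/
def Consistent (p q : ℕ) (ξ υ : ℕ → ℤ) (l : ℤ) (T : Set Vtx) : Prop :=
  ∃ R : Finset ((ℕ × ℕ) × (ℕ × ℕ) × ℤ),
    (∀ r ∈ R, 1 ≤ r.1.1 ∧ r.1.1 ≤ r.1.2 ∧ r.1.2 ≤ p ∧
       1 ≤ r.2.1.1 ∧ r.2.1.1 ≤ r.2.1.2 ∧ r.2.1.2 ≤ q ∧ 1 ≤ r.2.2 ∧ r.2.2 ≤ l) ∧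
    T = ⋃ r ∈ R, GridRect ξ υ r.1.1 r.1.2 r.2.1.1 r.2.1.2 r.2.2

/-- `kval p q l ch cv` is the number `k` of distinct values among all horizontal and vertical
edge costs `ch i j z` and `cv i j z` for `i ∈ {0,…,p}`, `j ∈ {0,…,q}`, `z ∈ {1,…,l}`. -/
noncomputable def kval (p q : ℕ) (l : ℤ) (ch cv : ℕ → ℕ → ℤ → ℝ) : ℕ :=
  (((Finset.range (p + 1) ×ˢ Finset.range (q + 1) ×ˢ Finset.Icc 1 l).image
      fun w => ch w.1 w.2.1 w.2.2) ∪
    ((Finset.range (p + 1) ×ˢ Finset.range (q + 1) ×ˢ Finset.Icc 1 l).image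
      fun w => cv w.1 w.2.1 w.2.2)).card


/-- `Wk A c T u m`: there is a walk from `u` to `T` of cost exactly `m`. -/
inductive Wk (A : Vtx → Vtx → Prop) (c : Vtx → Vtx → ℝ) (T : Set Vtx) : Vtx → ℝ → Prop
  | base (u : Vtx) (h : u ∈ T) : Wk A c T u 0
  | step (u v : Vtx) (m : ℝ) (h : A u v) (hv : Wk A c T v m) : Wk A c T u (c u v + m)

theorem wk_of_walk (A : Vtx → Vtx → Prop) (c : Vtx → Vtx → ℝ) (T : Set Vtx) (P : List Vtx) :
    ∀ u v, v ∈ T → IsWalkA A P u v → Wk A c T u (wcost c P) := by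
  induction P with
  | nil => intro u v _ h; exact absurd rfl h.1
  | cons a P ih =>
    intro u v hv h
    obtain ⟨-, hc, hh, hl⟩ := h
    simp at hh
    subst hh
    cases P with
    | nil =>
      simp at hl
      subst hl
      simpa [wcost] using Wk.base a hv
    | cons b P =>
      simp only [wcost]
      have hc' : (a :: b :: P).IsChain A := hc
      rw [List.isChain_cons_cons] at hc'
      refine Wk.step a b _ hc'.1 (ih b v hv ⟨by simp, hc'.2, by simp, ?_⟩)
      simpa using hl

theorem walk_of_wk (A : Vtx → Vtx → Prop) (c : Vtx → Vtx → ℝ) (T : Set Vtx) (u : Vtx) (m : ℝ)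
    (h : Wk A c T u m) : ∃ P v, v ∈ T ∧ IsWalkA A P u v ∧ wcost c P = m := by
  induction h with
  | base u h =>
    exact ⟨[u], u, h, ⟨by simp, List.isChain_singleton u, by simp, by simp⟩, by simp [wcost]⟩
  | step u v m h hv ih =>
    obtain ⟨P, t, ht, ⟨hne, hc, hh, hl⟩, hm⟩ := ih
    cases P with
    | nil => exact absurd rfl hne
    | cons b P =>
      simp at hh
      subst hh
      refine ⟨u :: b :: P, t, ht, ⟨by simp, ?_, by simp, ?_⟩, ?_⟩
      · exact List.isChain_cons_cons.2 ⟨h, hc⟩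
      · simpa using hl
      · simp only [wcost, hm]

theorem gdist_eq (A : Vtx → Vtx → Prop) (c : Vtx → Vtx → ℝ) (T : Set Vtx) (u : Vtx) :
    gdistSetA A c u T = sInf {m | Wk A c T u m} := by
  unfold gdistSetA
  congr 1
  ext m
  constructor
  · rintro ⟨P, v, hv, hw, rfl⟩
    exact wk_of_walk A c T P u v hv hw
  · exact walk_of_wk A c T u m

/-- Walk of cost at most `m`. -/
def Rk (A : Vtx → Vtx → Prop) (c : Vtx → Vtx → ℝ) (T : Set Vtx) (u : Vtx) (m : ℝ) : Prop :=
  ∃ m' ≤ m, Wk A c T u m'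

theorem Rk.mono {A : Vtx → Vtx → Prop} {c : Vtx → Vtx → ℝ} {T : Set Vtx} {u : Vtx} {m n : ℝ}
    (h : Rk A c T u m) (hmn : m ≤ n) : Rk A c T u n := by
  obtain ⟨m', h1, h2⟩ := h
  exact ⟨m', h1.trans hmn, h2⟩

theorem Rk.step {A : Vtx → Vtx → Prop} {c : Vtx → Vtx → ℝ} {T : Set Vtx} {u v : Vtx} {m d : ℝ}
    (h : Rk A c T v m) (ha : A u v) (hd : c u v ≤ d) : Rk A c T u (d + m) := by
  obtain ⟨m', h1, h2⟩ := h
  exact ⟨c u v + m', by linarith, Wk.step u v m' ha h2⟩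

theorem int_conn (Q : ℤ → Prop) (lo hi : ℤ) (h : ∀ n, lo ≤ n → n + 1 ≤ hi → (Q n ↔ Q (n + 1)))
    (a b : ℤ) (ha : lo ≤ a) (ha' : a ≤ hi) (hb : lo ≤ b) (hb' : b ≤ hi) (hQ : Q a) : Q b := by
  have key : ∀ n : ℕ, lo + n ≤ hi → (Q lo ↔ Q (lo + n)) := by
    intro n
    induction n with
    | zero => intro _; simp
    | succ k ih =>
      intro hk
      push_cast at hk ⊢
      rw [ih (by omega), h (lo + k) (by omega) (by omega), add_assoc]
  have h1 := key (a - lo).toNat (by omega)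
  have h2 := key (b - lo).toNat (by omega)
  rw [show lo + ((a - lo).toNat : ℤ) = a by omega] at h1
  rw [show lo + ((b - lo).toNat : ℤ) = b by omega] at h2
  exact h2.1 (h1.2 hQ)

theorem conn (l : ℤ) (c : Vtx → Vtx → ℝ) (T : Set Vtx) (a b ζ x y z : ℤ) (hT : (a, b, ζ) ∈ T)
    (h1 : 1 ≤ ζ) (h2 : ζ ≤ l) (h3 : 1 ≤ z) (h4 : z ≤ l) : ∃ m, Wk (Adj l) c T (x, y, z) m := by
  have st : ∀ u v, Adj l u v → (∃ m, Wk (Adj l) c T v m) → ∃ m, Wk (Adj l) c T u m := by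
    rintro u v h ⟨m, hm⟩
    exact ⟨_, Wk.step u v m h hm⟩
  have e0 : ∃ m, Wk (Adj l) c T (a, b, ζ) m := ⟨0, Wk.base _ hT⟩
  have e1 : ∃ m, Wk (Adj l) c T (a, b, z) m := by
    refine int_conn (fun z => ∃ m, Wk (Adj l) c T (a, b, z) m) 1 l ?_ ζ z h1 h2 h3 h4 e0
    intro n hn hn'
    constructor <;> apply st <;> simp [Adj] <;> omega
  have e2 : ∃ m, Wk (Adj l) c T (a, y, z) m := by
    refine int_conn (fun y => ∃ m, Wk (Adj l) c T (a, y, z) m) (min b y) (max b y) ?_ b y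
      (by simp) (by simp) (by simp) (by simp) e1
    intro n hn hn'
    constructor <;> apply st <;> simp [Adj] <;> omega
  refine int_conn (fun x => ∃ m, Wk (Adj l) c T (x, y, z) m) (min a x) (max a x) ?_ a x
      (by simp) (by simp) (by simp) (by simp) e2
  intro n hn hn'
  constructor <;> apply st <;> simp [Adj] <;> omega

theorem mono_of (n : ℕ) (ξ : ℕ → ℤ) (hξ : ∀ i, 1 ≤ i → i < n → ξ i ≤ ξ (i + 1))
    (a b : ℕ) (ha : 1 ≤ a) (hab : a ≤ b) (hb : b ≤ n) : ξ a ≤ ξ b := by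
  induction b, hab using Nat.le_induction with
  | base => exact le_rfl
  | succ k hk ih => exact (ih (by omega)).trans (hξ k (by omega) (by omega))

/-- Strict interior of a segment. -/
def inInt (n : ℕ) (ξ : ℕ → ℤ) (i : ℕ) (x : ℤ) : Prop :=
  (i = 0 ∨ ξ i < x) ∧ (i = n ∨ x < ξ (i + 1))

theorem inInt_unique (n : ℕ) (ξ : ℕ → ℤ) (hξ : ∀ i, 1 ≤ i → i < n → ξ i ≤ ξ (i + 1))
    (i i' : ℕ) (x : ℤ) (hi : i ≤ n) (hi' : i' ≤ n) (h : inInt n ξ i x) (h' : inSeg n ξ i' x) :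
    i' = i := by
  obtain ⟨h1, h2⟩ := h
  obtain ⟨h3, h4⟩ := h'
  rcases lt_trichotomy i' i with hlt | heq | hlt
  · have := mono_of n ξ hξ (i' + 1) i (by omega) (by omega) hi
    omega
  · exact heq
  · have := mono_of n ξ hξ (i + 1) i' (by omega) (by omega) hi'
    omega

theorem exists_seg (n : ℕ) (υ : ℕ → ℤ) (y : ℤ) :
    ∃ j ≤ n, inSeg n υ j y ∧ inSeg n υ j (y + 1) := by
  classical
  let P : ℕ → Prop := fun j => j = 0 ∨ υ j ≤ y
  have h0 : P 0 := Or.inl rfl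
  have hs := Nat.findGreatest_spec (P := P) (Nat.zero_le n) h0
  have hle := Nat.findGreatest_le (P := P) n
  have hg : ∀ k, Nat.findGreatest P n < k → k ≤ n → ¬ P k :=
    fun k h1 h2 => Nat.findGreatest_is_greatest h1 h2
  generalize Nat.findGreatest P n = j at hs hle hg
  refine ⟨j, hle, ?_⟩
  have h3 : j = n ∨ y < υ (j + 1) := by
    rcases eq_or_lt_of_le hle with h | h
    · exact Or.inl h
    · have := hg (j + 1) (by omega) (by omega)
      simp only [P, not_or, not_le] at this
      exact Or.inr this.2
  simp only [P] at hs
  unfold inSeg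
  omega

theorem exists_seg2 (n : ℕ) (υ : ℕ → ℤ) (y y' : ℤ) (h : |y - y'| ≤ 1) :
    ∃ j ≤ n, inSeg n υ j y ∧ inSeg n υ j y' := by
  rw [abs_le] at h
  rcases lt_trichotomy y y' with hlt | heq | hlt
  · obtain ⟨j, h1, h2, h3⟩ := exists_seg n υ y
    exact ⟨j, h1, h2, by rwa [show y' = y + 1 by omega]⟩
  · obtain ⟨j, h1, h2, h3⟩ := exists_seg n υ y
    exact ⟨j, h1, h2, heq ▸ h2⟩
  · obtain ⟨j, h1, h2, h3⟩ := exists_seg n υ y'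
    exact ⟨j, h1, by rwa [show y = y' + 1 by omega], h2⟩

theorem gecost_bdd (p q : ℕ) (ξ υ : ℕ → ℤ) (ch cv cvia : ℕ → ℕ → ℤ → ℝ) (u v : Vtx) :
    BddBelow { m : ℝ | ∃ i j : ℕ, i ≤ p ∧ j ≤ q ∧
    inSeg p ξ i u.1 ∧ inSeg p ξ i v.1 ∧ inSeg q υ j u.2.1 ∧ inSeg q υ j v.2.1 ∧
    m = if u.1 ≠ v.1 then ch i j u.2.2
        else if u.2.1 ≠ v.2.1 then cv i j u.2.2
        else cvia i j (min u.2.2 v.2.2) } := by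
  apply Set.Finite.bddBelow
  refine Set.Finite.subset (Finset.finite_toSet
    ((Finset.range (p + 1) ×ˢ Finset.range (q + 1)).image (fun w : ℕ × ℕ =>
      if u.1 ≠ v.1 then ch w.1 w.2 u.2.2
        else if u.2.1 ≠ v.2.1 then cv w.1 w.2 u.2.2
        else cvia w.1 w.2 (min u.2.2 v.2.2)))) ?_
  rintro m ⟨i, j, hi, hj, -, -, -, -, rfl⟩
  rw [Finset.mem_coe, Finset.mem_image]
  exact ⟨(i, j), by simp; omega, rfl⟩

theorem gecost_nonneg (l : ℤ) (p q : ℕ) (ξ υ : ℕ → ℤ) (ch cv cvia : ℕ → ℕ → ℤ → ℝ)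
    (hch : ∀ i j z, i ≤ p → j ≤ q → 1 ≤ z → z ≤ l → 0 < ch i j z)
    (hcv : ∀ i j z, i ≤ p → j ≤ q → 1 ≤ z → z ≤ l → 0 < cv i j z)
    (hcvia : ∀ i j z, i ≤ p → j ≤ q → 1 ≤ z → z < l → 0 < cvia i j z)
    (u v : Vtx) (h : Adj l u v) : 0 ≤ gecost p q ξ υ ch cv cvia u v := by
  apply Real.sInf_nonneg
  rintro m ⟨i, j, hi, hj, -, -, -, -, rfl⟩
  obtain ⟨h1, h2, h3, h4, h5⟩ := h
  split_ifs with ha hb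
  · exact (hch i j _ hi hj h1 h2).le
  · exact (hcv i j _ hi hj h1 h2).le
  · simp only [not_not] at ha hb
    rw [ha, hb] at h5
    simp at h5
    refine (hcvia i j _ hi hj (by omega) ?_).le
    rcases abs_cases (u.2.2 - v.2.2) with h | h <;> omega

theorem wk_nonneg (A : Vtx → Vtx → Prop) (c : Vtx → Vtx → ℝ) (T : Set Vtx)
    (h : ∀ u v, A u v → 0 ≤ c u v) (u : Vtx) (m : ℝ) (hw : Wk A c T u m) : 0 ≤ m := by
  induction hw with
  | base => exact le_rfl
  | step u v m ha _ ih => have := h u v ha; linarith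

theorem seg_between (n : ℕ) (ξ : ℕ → ℤ) (i : ℕ) (a b t : ℤ) (ha : inSeg n ξ i a)
    (hb : inSeg n ξ i b) (h : a ≤ t ∧ t ≤ b ∨ b ≤ t ∧ t ≤ a) : inSeg n ξ i t := by
  unfold inSeg at *
  omega

theorem hmove (l : ℤ) (p q : ℕ) (ξ υ : ℕ → ℤ) (ch cv cvia : ℕ → ℕ → ℤ → ℝ) (T : Set Vtx)
    (i j : ℕ) (hi : i ≤ p) (hj : j ≤ q) (y z : ℤ) (h1 : 1 ≤ z) (h2 : z ≤ l)
    (hy : inSeg q υ j y) (x x' : ℤ) (hx : inSeg p ξ i x) (hx' : inSeg p ξ i x') (m : ℝ)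
    (h : Rk (Adj l) (gecost p q ξ υ ch cv cvia) T (x, y, z) m) :
    Rk (Adj l) (gecost p q ξ υ ch cv cvia) T (x', y, z) (ch i j z * |(x' : ℝ) - x| + m) := by
  have est : ∀ a b : ℤ, inSeg p ξ i a → inSeg p ξ i b → a ≠ b →
      gecost p q ξ υ ch cv cvia (a, y, z) (b, y, z) ≤ ch i j z := by
    intro a b ha hb hab
    apply csInf_le (gecost_bdd p q ξ υ ch cv cvia _ _)
    exact ⟨i, j, hi, hj, ha, hb, hy, hy, by simp [hab]⟩
  have key : ∀ e : ℤ, (e = 1 ∨ e = -1) → ∀ n : ℕ, inSeg p ξ i (x + e * n) →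
      Rk (Adj l) (gecost p q ξ υ ch cv cvia) T (x + e * n, y, z) (ch i j z * n + m) := by
    intro e he n
    induction n with
    | zero => intro _; simpa using h
    | succ k ih =>
      intro hk
      push_cast at hk ⊢
      have hk' : inSeg p ξ i (x + e * k) := by
        apply seg_between p ξ i _ _ _ hx hk
        rcases he with rfl | rfl <;> omega
      have hne : x + e * (k + 1) ≠ x + e * k := by rcases he with rfl | rfl <;> omega
      refine ((ih hk').step (u := (x + e * (k + 1), y, z)) ?_ (est _ _ hk hk' hne)).mono ?_
      · refine ⟨h1, h2, h1, h2, ?_⟩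
        rcases he with rfl | rfl <;> simp
      · linarith
  rcases le_total x x' with hle | hle
  · have := key 1 (Or.inl rfl) (x' - x).toNat
    have e : ((x' - x).toNat : ℤ) = x' - x := by omega
    have e' : (((x' - x).toNat : ℕ) : ℝ) = |(x' : ℝ) - x| := by
      have h0 : (x : ℝ) ≤ x' := by exact_mod_cast hle
      rw [abs_of_nonneg (by linarith)]
      exact_mod_cast e
    rw [e, e', show x + 1 * (x' - x) = x' by ring] at this
    exact this hx'
  · have := key (-1) (Or.inr rfl) (x - x').toNat
    have e : ((x - x').toNat : ℤ) = x - x' := by omega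
    have e' : (((x - x').toNat : ℕ) : ℝ) = |(x' : ℝ) - x| := by
      have h0 : (x' : ℝ) ≤ x := by exact_mod_cast hle
      rw [abs_of_nonpos (by linarith), neg_sub]
      exact_mod_cast e
    rw [e, e', show x + -1 * (x - x') = x' by ring] at this
    exact this hx'

theorem row_T (l : ℤ) (p q : ℕ) (ξ υ : ℕ → ℤ)
    (hξ : ∀ i, 1 ≤ i → i < p → ξ i ≤ ξ (i + 1)) (T : Set Vtx) (hT : Consistent p q ξ υ l T)
    (i : ℕ) (hi : i ≤ p) (x x' y z : ℤ) (hx : inInt p ξ i x) (hx' : inSeg p ξ i x')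
    (h : (x, y, z) ∈ T) : (x', y, z) ∈ T := by
  obtain ⟨R, hR, rfl⟩ := hT
  simp only [Set.mem_iUnion] at h ⊢
  obtain ⟨r, hr, h1, h2, h3⟩ := h
  refine ⟨r, hr, ?_, ?_, h3⟩
  all_goals
    obtain ⟨a1, a2, a3, -⟩ := hR r hr
    obtain ⟨b1, b2⟩ := hx
    obtain ⟨c1, c2⟩ := hx'
    simp only at h1 h2 ⊢
  · have hle : r.1.1 ≤ i := by
      by_contra hc
      have := mono_of p ξ hξ (i + 1) r.1.1 (by omega) (by omega) (by omega)
      omega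
    have := mono_of p ξ hξ r.1.1 i a1 hle hi
    omega
  · have hle : i + 1 ≤ r.1.2 := by
      by_contra hc
      have := mono_of p ξ hξ r.1.2 i (by omega) (by omega) (by omega)
      omega
    have := mono_of p ξ hξ (i + 1) r.1.2 (by omega) hle (by omega)
    omega

/-- minimal horizontal cost row -/
theorem exists_minrow (q : ℕ) (υ : ℕ → ℤ) (ch : ℕ → ℕ → ℤ → ℝ) (i : ℕ) (y z : ℤ) :
    ∃ j ≤ q, inSeg q υ j y ∧ ∀ j' ≤ q, inSeg q υ j' y → ch i j z ≤ ch i j' z := by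
  classical
  obtain ⟨j0, h0, h1, -⟩ := exists_seg q υ y
  obtain ⟨j, hj, hm⟩ := Finset.exists_min_image
    ((Finset.range (q + 1)).filter (fun j => inSeg q υ j y)) (fun j => ch i j z)
    ⟨j0, by simp [h1]; omega⟩
  simp only [Finset.mem_filter, Finset.mem_range] at hj hm
  exact ⟨j, by omega, hj.2, fun k h hk => hm k ⟨by omega, hk⟩⟩

/-- The key claim, by induction on the walk. -/
theorem key_claim (l : ℤ) (p q : ℕ) (ξ υ : ℕ → ℤ)
    (hξ : ∀ i, 1 ≤ i → i < p → ξ i ≤ ξ (i + 1))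
    (ch cv cvia : ℕ → ℕ → ℤ → ℝ)
    (hch : ∀ i j z, i ≤ p → j ≤ q → 1 ≤ z → z ≤ l → 0 < ch i j z)
    (T : Set Vtx) (hT : Consistent p q ξ υ l T) (i : ℕ) (hi : i ≤ p) (u : Vtx) (w : ℝ)
    (hw : Wk (Adj l) (gecost p q ξ υ ch cv cvia) T u w) :
    inSeg p ξ i u.1 → 1 ≤ u.2.2 → u.2.2 ≤ l →
    ∃ s b : ℝ, (s = 0 ∨ ∃ (j' : ℕ) (z' : ℤ), j' ≤ q ∧ 1 ≤ z' ∧ z' ≤ l ∧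
          (s = ch i j' z' ∨ s = -ch i j' z')) ∧
      (∀ j' ≤ q, inSeg q υ j' u.2.1 → |s| ≤ ch i j' u.2.2) ∧
      (0 < s → i ≠ 0) ∧ (s < 0 → i ≠ p) ∧
      s * u.1 + b ≤ w ∧
      ∀ x', inSeg p ξ i x' →
        Rk (Adj l) (gecost p q ξ υ ch cv cvia) T (x', u.2.1, u.2.2) (s * x' + b) := by
  -- moving out of a boundary vertex
  have bdry : ∀ (x y z : ℤ) (m : ℝ), inSeg p ξ i x → 1 ≤ z → z ≤ l →
      Rk (Adj l) (gecost p q ξ υ ch cv cvia) T (x, y, z) m →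
      ∃ C : ℝ, 0 < C ∧ (∃ (j' : ℕ) (z' : ℤ), j' ≤ q ∧ 1 ≤ z' ∧ z' ≤ l ∧ C = ch i j' z') ∧
      (∀ j' ≤ q, inSeg q υ j' y → C ≤ ch i j' z) ∧
      (∃ j' ≤ q, inSeg q υ j' y ∧ C = ch i j' z) ∧
      ∀ x', inSeg p ξ i x' →
        Rk (Adj l) (gecost p q ξ υ ch cv cvia) T (x', y, z) (C * |(x' : ℝ) - x| + m) := by
    intro x y z m hx h1 h2 hR
    obtain ⟨j, hj, hy, hmin⟩ := exists_minrow q υ ch i y z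
    exact ⟨ch i j z, hch i j z hi hj h1 h2, ⟨j, z, hj, h1, h2, rfl⟩, hmin, ⟨j, hj, hy, rfl⟩,
      fun x' hx' => hmove l p q ξ υ ch cv cvia T i j hi hj y z h1 h2 hy x x' hx hx' m hR⟩
  have left : ∀ (y z : ℤ) (m : ℝ), i ≠ 0 → inSeg p ξ i (ξ i) → 1 ≤ z → z ≤ l →
      Rk (Adj l) (gecost p q ξ υ ch cv cvia) T (ξ i, y, z) m →
      ∃ C : ℝ, 0 < C ∧ (∃ (j' : ℕ) (z' : ℤ), j' ≤ q ∧ 1 ≤ z' ∧ z' ≤ l ∧ C = ch i j' z') ∧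
      (∀ j' ≤ q, inSeg q υ j' y → C ≤ ch i j' z) ∧
      (∃ j' ≤ q, inSeg q υ j' y ∧ C = ch i j' z) ∧
      ∀ x', inSeg p ξ i x' →
        Rk (Adj l) (gecost p q ξ υ ch cv cvia) T (x', y, z) (C * x' + (m - C * ξ i)) := by
    intro y z m h0 hx h1 h2 hR
    obtain ⟨C, a1, a2, a3, a4, a5⟩ := bdry _ y z m hx h1 h2 hR
    refine ⟨C, a1, a2, a3, a4, fun x' hx' => (a5 x' hx').mono ?_⟩
    have : (ξ i : ℝ) ≤ x' := by exact_mod_cast hx'.1.resolve_left h0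
    rw [abs_of_nonneg (by linarith)]
    linarith
  have right : ∀ (y z : ℤ) (m : ℝ), i ≠ p → inSeg p ξ i (ξ (i + 1)) → 1 ≤ z → z ≤ l →
      Rk (Adj l) (gecost p q ξ υ ch cv cvia) T (ξ (i + 1), y, z) m →
      ∃ C : ℝ, 0 < C ∧ (∃ (j' : ℕ) (z' : ℤ), j' ≤ q ∧ 1 ≤ z' ∧ z' ≤ l ∧ C = ch i j' z') ∧
      (∀ j' ≤ q, inSeg q υ j' y → C ≤ ch i j' z) ∧
      (∃ j' ≤ q, inSeg q υ j' y ∧ C = ch i j' z) ∧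
      ∀ x', inSeg p ξ i x' →
        Rk (Adj l) (gecost p q ξ υ ch cv cvia) T (x', y, z) (-C * x' + (m + C * ξ (i + 1))) := by
    intro y z m h0 hx h1 h2 hR
    obtain ⟨C, a1, a2, a3, a4, a5⟩ := bdry _ y z m hx h1 h2 hR
    refine ⟨C, a1, a2, a3, a4, fun x' hx' => (a5 x' hx').mono ?_⟩
    have : (x' : ℝ) ≤ ξ (i + 1) := by exact_mod_cast hx'.2.resolve_left h0
    rw [abs_of_nonpos (by linarith)]
    linarith
  -- boundary vertices are always fine
  have triv : ∀ (x y z : ℤ) (m : ℝ), Wk (Adj l) (gecost p q ξ υ ch cv cvia) T (x, y, z) m →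
      inSeg p ξ i x → ¬ inInt p ξ i x → 1 ≤ z → z ≤ l →
      ∃ s b : ℝ, (s = 0 ∨ ∃ (j' : ℕ) (z' : ℤ), j' ≤ q ∧ 1 ≤ z' ∧ z' ≤ l ∧
          (s = ch i j' z' ∨ s = -ch i j' z')) ∧
      (∀ j' ≤ q, inSeg q υ j' y → |s| ≤ ch i j' z) ∧
      (0 < s → i ≠ 0) ∧ (s < 0 → i ≠ p) ∧
      s * x + b ≤ m ∧
      ∀ x', inSeg p ξ i x' →
        Rk (Adj l) (gecost p q ξ υ ch cv cvia) T (x', y, z) (s * x' + b) := by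
    intro x y z m hW hx hn h1 h2
    have hc : (i ≠ 0 ∧ x = ξ i) ∨ (i ≠ p ∧ x = ξ (i + 1)) := by
      unfold inSeg at hx
      unfold inInt at hn
      omega
    rcases hc with ⟨h0, rfl⟩ | ⟨h0, rfl⟩
    · obtain ⟨C, a1, ⟨j', z', b1, b2, b3, b4⟩, a3, a4, a5⟩ :=
        left y z m h0 hx h1 h2 ⟨m, le_rfl, hW⟩
      exact ⟨C, m - C * ξ i, Or.inr ⟨j', z', b1, b2, b3, Or.inl b4⟩,
        by rwa [abs_of_pos a1], fun _ => h0, fun h => by linarith, by linarith, a5⟩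
    · obtain ⟨C, a1, ⟨j', z', b1, b2, b3, b4⟩, a3, a4, a5⟩ :=
        right y z m h0 hx h1 h2 ⟨m, le_rfl, hW⟩
      exact ⟨-C, m + C * ξ (i + 1), Or.inr ⟨j', z', b1, b2, b3, Or.inr (by rw [b4])⟩,
        by rwa [abs_neg, abs_of_pos a1], fun h => by linarith, fun _ => h0, by linarith, a5⟩
  induction hw with
  | base u hu =>
    obtain ⟨x, y, z⟩ := u
    intro hx h1 h2
    by_cases hinner : inInt p ξ i x
    · refine ⟨0, 0, Or.inl rfl, fun j' hj' _ => ?_, by simp, by simp, by simp, fun x' hx' => ?_⟩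
      · simpa using (hch i j' z hi hj' h1 h2).le
      · exact ⟨0, by simp, Wk.base _ (row_T l p q ξ υ hξ T hT i hi x x' y z hinner hx' hu)⟩
    · exact triv x y z 0 (Wk.base _ hu) hx hinner h1 h2
  | step u v m ha hv ih =>
    obtain ⟨x, y, z⟩ := u
    obtain ⟨x1, y1, z1⟩ := v
    intro hx h1 h2
    by_cases hinner : inInt p ξ i x
    swap
    · exact triv x y z _ (Wk.step _ _ _ ha hv) hx hinner h1 h2
    have ha' := ha
    obtain ⟨-, -, h3, h4, h5⟩ := ha'
    simp only at hx h1 h2 h3 h4 h5 ih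
    have hx1 : inSeg p ξ i x1 := by
      unfold inInt at hinner
      unfold inSeg
      rcases abs_cases (x - x1) with h | h <;> rcases abs_cases (y - y1) with h' | h' <;>
      rcases abs_cases (z - z1) with h'' | h'' <;> omega
    obtain ⟨s, b, i1, i2, i3, i4, i5, i6⟩ := ih hx1 h3 h4
    have hyy : |y - y1| ≤ 1 := by
      have := abs_nonneg (x - x1); have := abs_nonneg (z - z1); omega
    obtain ⟨jj, hjj, hjy, hjy1⟩ := exists_seg2 q υ y y1 hyy
    by_cases hxx : x = x1
    · subst hxx
      -- vertical edge or via
      have hmono : ∀ x', inSeg p ξ i x' →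
          gecost p q ξ υ ch cv cvia (x', y, z) (x', y1, z1) ≤
            gecost p q ξ υ ch cv cvia (x, y, z) (x, y1, z1) := by
        intro x' hx'
        apply csInf_le_csInf (gecost_bdd p q ξ υ ch cv cvia _ _)
        · exact ⟨_, i, jj, hi, hjj, hx, hx, hjy, hjy1, rfl⟩
        · rintro _ ⟨i', j', c1, c2, c3, c4, c5, c6, rfl⟩
          have := inInt_unique p ξ hξ i i' x hi c1 hinner c3
          subst this
          exact ⟨i', j', c1, c2, hx', hx', c5, c6, by simp⟩
      generalize gecost p q ξ υ ch cv cvia (x, y, z) (x, y1, z1) = g at hmono ⊢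
      have hadj : ∀ x', Adj l (x', y, z) (x', y1, z1) := by
        intro x'
        refine ⟨h1, h2, h3, h4, ?_⟩
        simpa using h5
      have hstep : ∀ x', inSeg p ξ i x' →
          Rk (Adj l) (gecost p q ξ υ ch cv cvia) T (x', y, z) (g + (s * x' + b)) :=
        fun x' hx' => (i6 x' hx').step (hadj x') (hmono x' hx')
      by_cases hs : ∀ j' ≤ q, inSeg q υ j' y → |s| ≤ ch i j' z
      · refine ⟨s, g + b, i1, hs, i3, i4, ?_, fun x' hx' => (hstep x' hx').mono ?_⟩
        · simp only at i5 ⊢; linarith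
        · linarith
      · push Not at hs
        obtain ⟨j2, hj2, hj2y, hlt⟩ := hs
        rcases lt_trichotomy s 0 with hneg | hzero | hpos
        · have h0 := i4 hneg
          have hin : inSeg p ξ i (ξ (i + 1)) := by
            unfold inSeg at hx ⊢; omega
          obtain ⟨C, a1, ⟨j', z', b1, b2, b3, b4⟩, a3, a4, a5⟩ :=
            right y z _ h0 hin h1 h2 (hstep _ hin)
          refine ⟨-C, _, Or.inr ⟨j', z', b1, b2, b3, Or.inr (by rw [b4])⟩,
            by rwa [abs_neg, abs_of_pos a1], fun h => by linarith, fun _ => h0, ?_, a5⟩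
          have hCs : C ≤ -s := by
            have := a3 j2 hj2 hj2y
            rw [abs_of_neg hneg] at hlt
            linarith
          have hxr : (x : ℝ) ≤ ξ (i + 1) := by exact_mod_cast hx.2.resolve_left h0
          simp only at i5 ⊢
          nlinarith [mul_nonneg (sub_nonneg.2 hCs) (sub_nonneg.2 hxr)]
        · have := hch i j2 z hi hj2 h1 h2
          rw [hzero, abs_zero] at hlt
          linarith
        · have h0 := i3 hpos
          have hin : inSeg p ξ i (ξ i) := by
            unfold inSeg at hx ⊢; omega
          obtain ⟨C, a1, ⟨j', z', b1, b2, b3, b4⟩, a3, a4, a5⟩ :=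
            left y z _ h0 hin h1 h2 (hstep _ hin)
          refine ⟨C, _, Or.inr ⟨j', z', b1, b2, b3, Or.inl b4⟩,
            by rwa [abs_of_pos a1], fun _ => h0, fun h => by linarith, ?_, a5⟩
          have hCs : C ≤ s := by
            have := a3 j2 hj2 hj2y
            rw [abs_of_pos hpos] at hlt
            linarith
          have hxr : (ξ i : ℝ) ≤ x := by exact_mod_cast hx.1.resolve_left h0
          simp only at i5 ⊢
          nlinarith [mul_nonneg (sub_nonneg.2 hCs) (sub_nonneg.2 hxr)]
    · -- horizontal edge
      have hpos : 1 ≤ |x - x1| := Int.one_le_abs (by omega)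
      have hy0 : y = y1 := by
        have := abs_nonneg (y - y1); have := abs_nonneg (z - z1)
        have h : |y - y1| = 0 := by omega
        rw [abs_eq_zero] at h; omega
      have hz0 : z = z1 := by
        have := abs_nonneg (y - y1); have := abs_nonneg (z - z1)
        have h : |z - z1| = 0 := by omega
        rw [abs_eq_zero] at h; omega
      subst hy0
      subst hz0
      have hg : |s| ≤ gecost p q ξ υ ch cv cvia (x, y, z) (x1, y, z) := by
        apply le_csInf
        · exact ⟨_, i, jj, hi, hjj, hx, hx1, hjy, hjy, rfl⟩
        · rintro _ ⟨i', j', c1, c2, c3, c4, c5, c6, rfl⟩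
          have := inInt_unique p ξ hξ i i' x hi c1 hinner c3
          subst this
          simpa [hxx] using i2 j' c2 c5
      refine ⟨s, b, i1, i2, i3, i4, ?_, i6⟩
      have habs : |(x : ℝ) - x1| = 1 := by
        have : |x - x1| = 1 := by simpa using h5
        exact_mod_cast this
      have hsx : s * ((x : ℝ) - x1) ≤ |s| := by
        calc s * ((x : ℝ) - x1) ≤ |s * ((x : ℝ) - x1)| := le_abs_self _
          _ = |s| := by rw [abs_mul, habs, mul_one]
      simp only at i5 ⊢
      linarith

/-- Abstract selection lemma. -/
theorem select (S : Finset ℝ) (I : Set ℤ) (D : ℤ → ℝ)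
    (h : ∀ x ∈ I, ∀ ε > 0, ∃ s ∈ S, ∃ b, s * x + b < D x + ε ∧ ∀ y ∈ I, D y ≤ s * y + b) :
    ∃ F : Finset (ℝ × ℝ), F.card ≤ S.card ∧ (∀ f ∈ F, f.1 ∈ S) ∧
      ∀ x ∈ I, IsLeast {m : ℝ | ∃ f ∈ F, m = f.1 * (x : ℝ) + f.2} (D x) := by
  classical
  let G : Set (ℝ × ℝ) := {f | f.1 ∈ S ∧ (∃ x ∈ I, D x = f.1 * x + f.2) ∧
    ∀ y ∈ I, D y ≤ f.1 * y + f.2}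
  have hinj : Set.InjOn Prod.fst G := by
    rintro ⟨a, b⟩ ⟨-, ⟨x, hx, hxe⟩, hu⟩ ⟨a', b'⟩ ⟨-, ⟨x', hx', hxe'⟩, hu'⟩ hab
    simp only at *
    subst hab
    have := hu x' hx'
    have := hu' x hx
    ext
    · rfl
    · simp only; linarith
  have himg : Prod.fst '' G ⊆ (S : Set ℝ) := by
    rintro _ ⟨f, hf, rfl⟩
    exact hf.1
  have hfin : G.Finite := Set.Finite.of_finite_image ((S.finite_toSet).subset himg) hinj
  refine ⟨hfin.toFinset, ?_, ?_, ?_⟩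
  · apply Finset.card_le_card_of_injOn Prod.fst
    · intro f hf
      exact himg ⟨f, by simpa using hf, rfl⟩
    · simpa using hinj
  · intro f hf
    exact ((Set.Finite.mem_toFinset _).1 hf).1
  · intro x hx
    refine ⟨?_, ?_⟩
    · by_contra hcon
      have gap : ∀ s ∈ S, ∃ ε > 0, ∀ b, (∀ y ∈ I, D y ≤ s * y + b) → D x + ε ≤ s * x + b := by
        intro s hs
        have : ¬ ∀ y ∈ I, D y ≤ s * y + (D x - s * x) := by
          intro hall
          apply hcon
          refine ⟨(s, D x - s * x), ?_, by simp⟩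
          rw [Set.Finite.mem_toFinset]
          exact ⟨hs, ⟨x, hx, by simp⟩, hall⟩
        push Not at this
        obtain ⟨y, hy, hlt⟩ := this
        refine ⟨D y - (s * y + (D x - s * x)), by linarith, fun b hb => ?_⟩
        have := hb y hy
        linarith
      choose! e he1 he2 using gap
      obtain ⟨s0, hs0, b0, -⟩ := h x hx 1 one_pos
      obtain ⟨t, ht, hmin⟩ := Finset.exists_min_image S e ⟨s0, hs0⟩
      obtain ⟨s, hs, b, hb1, hb2⟩ := h x hx (e t) (he1 t ht)
      have := he2 s hs b hb2
      have := hmin s hs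
      linarith
    · rintro m ⟨f, hf, rfl⟩
      exact ((Set.Finite.mem_toFinset _).1 hf).2.2 x hx

/-- In the general cost model with target set `T` consistent with the grid,
for every horizontal segment (given by `i ∈ {0,…,p}`, `j ∈ {1,…,q}`, `z ∈ {1,…,l}`) there is
a set `F` of at most `2k' + 1` affine functions (each represented by its slope-intercept
pair) whose pointwise minimum at `x` is the distance from `(x, υ^j, z)` to `T`; moreover
each slope is `0` or of the form `± ch i j' z'`. -/
theorem stmt10 (l : ℤ) (hl : 1 ≤ l) (p q : ℕ) (ξ υ : ℕ → ℤ)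
    (hξ : ∀ i, 1 ≤ i → i < p → ξ i ≤ ξ (i + 1)) (hυ : ∀ j, 1 ≤ j → j < q → υ j ≤ υ (j + 1))
    (ch cv cvia : ℕ → ℕ → ℤ → ℝ)
    (hch : ∀ i j z, i ≤ p → j ≤ q → 1 ≤ z → z ≤ l → 0 < ch i j z)
    (hcv : ∀ i j z, i ≤ p → j ≤ q → 1 ≤ z → z ≤ l → 0 < cv i j z)
    (hcvia : ∀ i j z, i ≤ p → j ≤ q → 1 ≤ z → z < l → 0 < cvia i j z)
    (T : Set Vtx) (hTne : T.Nonempty) (hTcon : Consistent p q ξ υ l T) :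
    ∀ (i j : ℕ) (z : ℤ), i ≤ p → 1 ≤ j → j ≤ q → 1 ≤ z → z ≤ l →
      ∃ F : Finset (ℝ × ℝ),
        F.card ≤ 2 * min (kval p q l ch cv) ((q + 1) * l.toNat) + 1 ∧
        (∀ f ∈ F, f.1 = 0 ∨ ∃ (j' : ℕ) (z' : ℤ), j' ≤ q ∧ 1 ≤ z' ∧ z' ≤ l ∧
          (f.1 = ch i j' z' ∨ f.1 = -ch i j' z')) ∧
        ∀ x : ℤ, inSeg p ξ i x →
          IsLeast { m : ℝ | ∃ f ∈ F, m = f.1 * (x : ℝ) + f.2 }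
            (gdistSetA (Adj l) (gecost p q ξ υ ch cv cvia) (x, υ j, z) T) := by
  classical
  intro i j z hi hj1 hj hz1 hz2
  set c := gecost p q ξ υ ch cv cvia with hc
  let M : Finset ℝ := (Finset.range (q + 1) ×ˢ Finset.Icc 1 l).image fun w => ch i w.1 w.2
  let S : Finset ℝ := {0} ∪ (M ∪ M.image (fun t => -t))
  have hM1 : M.card ≤ (q + 1) * l.toNat := by
    refine Finset.card_image_le.trans ?_
    simp
  have hM2 : M.card ≤ kval p q l ch cv := by
    apply Finset.card_le_card
    intro t ht
    obtain ⟨w, hw, rfl⟩ := Finset.mem_image.1 ht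
    apply Finset.mem_union_left
    apply Finset.mem_image.2
    refine ⟨(i, w), ?_, rfl⟩
    rw [Finset.mem_product]
    exact ⟨by simp; omega, hw⟩
  have hS : S.card ≤ 2 * min (kval p q l ch cv) ((q + 1) * l.toNat) + 1 := by
    have h1 : S.card ≤ 1 + (M ∪ M.image (fun t => -t)).card := by
      exact Finset.card_union_le {(0 : ℝ)} (M ∪ M.image (fun t => -t))
    have h2 := Finset.card_union_le M (M.image (fun t => -t))
    have h3 : (M.image (fun t => -t)).card ≤ M.card := Finset.card_image_le
    omega
  have hmem : ∀ s, s ∈ S ↔ (s = 0 ∨ ∃ (j' : ℕ) (z' : ℤ), j' ≤ q ∧ 1 ≤ z' ∧ z' ≤ l ∧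
          (s = ch i j' z' ∨ s = -ch i j' z')) := by
    intro s
    simp only [S, M, Finset.mem_union, Finset.mem_singleton, Finset.mem_image,
      Finset.mem_product, Finset.mem_range, Finset.mem_Icc, Prod.exists]
    constructor
    · rintro (h | ⟨a, b, h, rfl⟩ | ⟨_, ⟨a, b, h, rfl⟩, rfl⟩)
      · exact Or.inl h
      · exact Or.inr ⟨a, b, by omega, h.2.1, h.2.2, Or.inl rfl⟩
      · exact Or.inr ⟨a, b, by omega, h.2.1, h.2.2, Or.inr rfl⟩
    · rintro (h | ⟨a, b, h1, h2, h3, rfl | rfl⟩)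
      · exact Or.inl h
      · exact Or.inr (Or.inl ⟨a, b, ⟨by omega, h2, h3⟩, rfl⟩)
      · exact Or.inr (Or.inr ⟨_, ⟨a, b, ⟨by omega, h2, h3⟩, rfl⟩, rfl⟩)
  have hbdd : ∀ u, BddBelow {m | Wk (Adj l) c T u m} := fun u =>
    ⟨0, fun m hm => wk_nonneg (Adj l) c T
      (gecost_nonneg l p q ξ υ ch cv cvia hch hcv hcvia) u m hm⟩
  have hne : ∀ x, ∃ m, Wk (Adj l) c T (x, υ j, z) m := by
    intro x
    obtain ⟨⟨a, b, ζ⟩, ht⟩ := hTne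
    have hζ : 1 ≤ ζ ∧ ζ ≤ l := by
      obtain ⟨R, hR, hTe⟩ := hTcon
      rw [hTe] at ht
      simp only [Set.mem_iUnion] at ht
      obtain ⟨r, hr, -, -, -, -, h5⟩ := ht
      obtain ⟨-, -, -, -, -, -, h6, h7⟩ := hR r hr
      simp only at h5
      omega
    exact conn l c T a b ζ x (υ j) z ht hζ.1 hζ.2 hz1 hz2
  obtain ⟨F, hF1, hF2, hF3⟩ := select S {x | inSeg p ξ i x}
    (fun x => gdistSetA (Adj l) c (x, υ j, z) T) (by
      intro x hx ε hε
      obtain ⟨w, hw, hlt⟩ := exists_lt_of_csInf_lt (s := {m | Wk (Adj l) c T (x, υ j, z) m})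
        (hne x) (lt_add_of_pos_right _ hε)
      obtain ⟨s, b, k1, -, -, -, k5, k6⟩ := key_claim l p q ξ υ hξ ch cv cvia hch T hTcon i hi
        (x, υ j, z) w hw hx hz1 hz2
      refine ⟨s, (hmem s).2 k1, b, ?_, ?_⟩
      · simp only [gdist_eq]
        exact lt_of_le_of_lt k5 hlt
      · intro y hy
        obtain ⟨m', hm', hW⟩ := k6 y hy
        simp only [gdist_eq]
        exact (csInf_le (hbdd _) hW).trans hm')
  exact ⟨F, hF1.trans hS, fun f hf => (hmem f.1).1 (hF2 f hf), hF3⟩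
end
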